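/- arXiv:1404.2443 — 3 statements merged into one kernel-verified Lean document; each statement's English description precedes it below -/
import Mathlib

section
/- The bound ⌈(n+4)/2⌉ for sections of 3-polytopes is optimal: for every m ≥ 2 there exist points p_0, …, p_{2m−1} ∈ ℝ² in clockwise convex position, a finite set V ⊆ ℝ³ with |V| = m + 2, and an injective affine map f : ℝ² → ℝ³ such that conv(V) ∩ range(f) = f(conv{p_0, …, p_{2m−1}}); that is, some 2m-gon is a section of a 3-polytope with m + 2 vertices. -/
open Matrix

/-- Homogeneous coordinates of a point in the plane. -/
noncomputable def hat (p : Fin 2 → ℝ) : Fin 3 → ℝ := ![p 0, p 1, 1]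

/-- Determinant of the 3×3 matrix with rows `u`, `v`, `w`. -/
def det3 (u v w : Fin 3 → ℝ) : ℝ := Matrix.det (Matrix.of ![u, v, w])

/-- The point of the parabola `y = -x²` with abscissa `x`. -/
noncomputable def parabola (x : ℝ) : Fin 2 → ℝ := ![x, -x ^ 2]

/-- The inclusion of the plane as the horizontal plane at height zero. -/
noncomputable def horizontal : (Fin 2 → ℝ) →ₗ[ℝ] (Fin 3 → ℝ) where
  toFun p := ![p 0, p 1, 0]
  map_add' p q := by ext i; fin_cases i <;> simp
  map_smul' c p := by ext i; fin_cases i <;> simp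

/-- A point above the horizontal plane. -/
noncomputable def apex (s : ℝ) : Fin 3 → ℝ := ![s, 0, 1]

/-- The point below the horizontal plane which is joined to `apex 1` and `apex (-1)` by segments
crossing that plane in the points of the parabola with abscissae `l` and `-l`. -/
noncomputable def foot (l : ℝ) : Fin 3 → ℝ := ![0, -l ^ 2 / (1 - l), -l / (1 - l)]

/-- The vertices of the polytope: the two apices and the feet with parameters in `L`. -/
noncomputable def apicesAndFeet (L : Finset ℝ) : Finset (Fin 3 → ℝ) :=
  insert (apex 1) (insert (apex (-1)) (L.image foot))

lemma horizontal_apply (p : Fin 2 → ℝ) (i : Fin 3) : horizontal p i = ![p 0, p 1, 0] i := rfl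

lemma apex_apply (s : ℝ) (i : Fin 3) : apex s i = ![s, 0, 1] i := rfl

lemma foot_apply (l : ℝ) (i : Fin 3) :
    foot l i = ![0, -l ^ 2 / (1 - l), -l / (1 - l)] i := rfl

lemma horizontal_injective : Function.Injective horizontal := by
  intro p q h
  have h0 := congrFun h 0
  have h1 := congrFun h 1
  simp only [horizontal, LinearMap.coe_mk, AddHom.coe_mk, cons_val_zero, cons_val_one] at h0 h1
  ext i
  fin_cases i
  · exact h0
  · exact h1

lemma det3_hat_parabola (x y z : ℝ) :
    det3 (hat (parabola x)) (hat (parabola y)) (hat (parabola z)) =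
      -((y - x) * (z - x) * (z - y)) := by
  simp [det3, hat, parabola, Matrix.det_fin_three]
  ring

lemma foot_injOn {L : Finset ℝ} (hL : ∀ l ∈ L, 0 < l ∧ l < 1) : Set.InjOn foot L := by
  intro a ha b hb h
  have ha' : 1 - a ≠ 0 := by linarith [(hL a ha).2]
  have hb' : 1 - b ≠ 0 := by linarith [(hL b hb).2]
  have h2 : -a / (1 - a) = -b / (1 - b) := congrFun h 2
  rw [div_eq_div_iff ha' hb'] at h2
  linarith

lemma apex_notMem_image_foot {L : Finset ℝ} (hL : ∀ l ∈ L, 0 < l ∧ l < 1) (s : ℝ) :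
    apex s ∉ L.image foot := by
  intro h
  obtain ⟨l, hl, h⟩ := Finset.mem_image.1 h
  have h2 : -l / (1 - l) = 1 := congrFun h 2
  have : 1 - l ≠ 0 := by linarith [(hL l hl).2]
  rw [div_eq_one_iff_eq this] at h2
  linarith

lemma apex_one_notMem {L : Finset ℝ} (hL : ∀ l ∈ L, 0 < l ∧ l < 1) :
    apex 1 ∉ insert (apex (-1)) (L.image foot) := by
  rw [Finset.mem_insert, not_or]
  refine ⟨fun h => ?_, apex_notMem_image_foot hL 1⟩
  have h0 : (1 : ℝ) = -1 := congrFun h 0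
  linarith

lemma card_apicesAndFeet {L : Finset ℝ} (hL : ∀ l ∈ L, 0 < l ∧ l < 1) :
    (apicesAndFeet L).card = L.card + 2 := by
  rw [apicesAndFeet, Finset.card_insert_of_notMem (apex_one_notMem hL),
    Finset.card_insert_of_notMem (apex_notMem_image_foot hL _),
    Finset.card_image_of_injOn (foot_injOn hL)]

lemma horizontal_parabola_mem_segment {l : ℝ} (h0 : 0 < l) (h1 : l < 1) (s : ℝ)
    (hs : s ^ 2 = 1) : horizontal (parabola (s * l)) ∈ segment ℝ (apex s) (foot l) := by
  refine ⟨l, 1 - l, h0.le, by linarith, by ring, ?_⟩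
  have h : 1 - l ≠ 0 := by linarith
  ext i
  fin_cases i
  · simp [horizontal, parabola, apex, foot, mul_comm]
  · simp [horizontal, parabola, apex, foot, mul_pow, hs]
    field_simp
  · simp [horizontal, parabola, apex, foot]
    field_simp
    ring

lemma convex_combination_of_parabola_mem {L : Finset ℝ} (hL : ∀ l ∈ L, 0 < l ∧ l < 1)
    {S : Set ℝ} (hS : ∀ l ∈ L, l ∈ S ∧ -l ∈ S) {α β : ℝ} {μ : ℝ → ℝ} (hα : 0 ≤ α) (hβ : 0 ≤ β)
    (hμ : ∀ l ∈ L, 0 ≤ μ l) (hsum : ∑ l ∈ L, μ l = 1) (hαβ : α + β = ∑ l ∈ L, μ l * l) :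
    ![α - β, -∑ l ∈ L, μ l * l ^ 2] ∈ convexHull ℝ (parabola '' S) := by
  have hpos : 0 < α + β := by
    rw [hαβ]
    obtain ⟨l, hl, hne⟩ := Finset.exists_ne_zero_of_sum_ne_zero
      (show ∑ l ∈ L, μ l ≠ 0 by rw [hsum]; exact one_ne_zero)
    exact Finset.sum_pos' (fun l hl => mul_nonneg (hμ l hl) (hL l hl).1.le)
      ⟨l, hl, mul_pos ((hμ l hl).lt_of_ne' hne) (hL l hl).1⟩
  have key : ![α - β, -∑ l ∈ L, μ l * l ^ 2] =
      ∑ l ∈ L, μ l • ((α / (α + β)) • parabola l + (β / (α + β)) • parabola (-l)) := by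
    have hw : α / (α + β) + β / (α + β) = 1 := by rw [← add_div, div_self hpos.ne']
    ext i
    fin_cases i
    · have : ∀ l, μ l * (α / (α + β) * l + -(β / (α + β) * l)) =
          μ l * l * ((α - β) / (α + β)) := fun l => by ring
      simp only [Fin.zero_eta, cons_val_zero, Finset.sum_apply, Pi.smul_apply, Pi.add_apply,
        parabola, smul_eq_mul, mul_neg, this, ← Finset.sum_mul, ← hαβ]
      field_simp
    · have : ∀ l, μ l * (α / (α + β) * -l ^ 2 + β / (α + β) * -(-l) ^ 2) = -(μ l * l ^ 2) :=
        fun l => by linear_combination (-(μ l * l ^ 2)) * hw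
      simp only [Fin.mk_one, cons_val_one, cons_val_zero, Finset.sum_apply, Pi.smul_apply,
        Pi.add_apply, parabola, smul_eq_mul, this, Finset.sum_neg_distrib]
  rw [key]
  refine (convex_convexHull ℝ _).sum_mem hμ hsum fun l hl => ?_
  exact convex_convexHull ℝ _ (subset_convexHull ℝ _ (Set.mem_image_of_mem _ (hS l hl).1))
    (subset_convexHull ℝ _ (Set.mem_image_of_mem _ (hS l hl).2)) (by positivity) (by positivity)
    (by rw [← add_div, div_self hpos.ne'])

/-- The horizontal section of the polytope is spanned by the points of the parabola with
abscissae `±l` for `l ∈ L`. -/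
lemma convexHull_apicesAndFeet_inter_range {L : Finset ℝ} (hL : ∀ l ∈ L, 0 < l ∧ l < 1)
    {S : Set ℝ} (hS : ∀ x, x ∈ S ↔ x ∈ L ∨ -x ∈ L) :
    convexHull ℝ (apicesAndFeet L : Set (Fin 3 → ℝ)) ∩ Set.range horizontal =
      horizontal '' convexHull ℝ (parabola '' S) := by
  apply Set.Subset.antisymm
  · rintro _ ⟨hv, q, rfl⟩
    refine ⟨q, ?_, rfl⟩
    obtain ⟨w, hw0, hw1, hw⟩ := Finset.mem_convexHull'.1 hv
    rw [apicesAndFeet, Finset.sum_insert (apex_one_notMem hL),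
      Finset.sum_insert (apex_notMem_image_foot hL _), Finset.sum_image (foot_injOn hL)] at hw1 hw
    have hfoot : ∀ l ∈ L, 0 ≤ w (foot l) := fun l hl =>
      hw0 _ (by simp only [apicesAndFeet, Finset.mem_insert, Finset.mem_image]
                exact Or.inr (Or.inr ⟨l, hl, rfl⟩))
    have e0 : w (apex 1) - w (apex (-1)) = q 0 := by
      simpa [Finset.sum_apply, horizontal_apply, apex_apply, foot_apply, ← sub_eq_add_neg] using congrFun hw 0
    have e1 : ∑ l ∈ L, w (foot l) * (-l ^ 2 / (1 - l)) = q 1 := by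
      simpa [Finset.sum_apply, horizontal_apply, apex_apply, foot_apply] using congrFun hw 1
    have e2 : w (apex 1) + (w (apex (-1)) + ∑ l ∈ L, w (foot l) * (-l / (1 - l))) = 0 := by
      simpa [Finset.sum_apply, horizontal_apply, apex_apply, foot_apply] using congrFun hw 2
    have hsub : ∀ l ∈ L, 0 < 1 - l := fun l hl => by linarith [(hL l hl).2]
    have s2 : ∑ l ∈ L, w (foot l) * (-l / (1 - l)) = -∑ l ∈ L, w (foot l) / (1 - l) * l := by
      rw [← Finset.sum_neg_distrib]
      exact Finset.sum_congr rfl fun l _ => by ring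
    have s0 : ∑ l ∈ L, w (foot l) / (1 - l) =
        ∑ l ∈ L, w (foot l) + ∑ l ∈ L, w (foot l) / (1 - l) * l := by
      rw [← Finset.sum_add_distrib]
      refine Finset.sum_congr rfl fun l hl => ?_
      have := (hsub l hl).ne'
      field_simp
      ring
    have s1 : ∑ l ∈ L, w (foot l) * (-l ^ 2 / (1 - l)) =
        -∑ l ∈ L, w (foot l) / (1 - l) * l ^ 2 := by
      rw [← Finset.sum_neg_distrib]
      exact Finset.sum_congr rfl fun l _ => by ring
    have hq : q = ![w (apex 1) - w (apex (-1)), -∑ l ∈ L, w (foot l) / (1 - l) * l ^ 2] := by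
      ext i
      fin_cases i
      · exact e0.symm
      · exact (s1.symm.trans e1).symm
    rw [hq]
    refine convex_combination_of_parabola_mem hL (μ := fun l => w (foot l) / (1 - l))
      (fun l hl => ⟨(hS l).2 (Or.inl hl), (hS (-l)).2 (Or.inr (by rwa [neg_neg]))⟩)
      (hw0 _ (by simp [apicesAndFeet])) (hw0 _ (by simp [apicesAndFeet]))
      (fun l hl => div_nonneg (hfoot l hl) (hsub l hl).le) ?_ ?_
    · linarith
    · linarith
  · refine Set.subset_inter ?_ (Set.image_subset_range _ _)
    rw [LinearMap.image_convexHull]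
    refine convexHull_min ?_ (convex_convexHull ℝ _)
    rintro _ ⟨_, ⟨x, hx, rfl⟩, rfl⟩
    have mem : ∀ l ∈ L, ∀ s : ℝ, s = 1 ∨ s = -1 → horizontal (parabola (s * l)) ∈
        convexHull ℝ (apicesAndFeet L : Set (Fin 3 → ℝ)) := by
      intro l hl s hs
      refine segment_subset_convexHull ?_ ?_
        (horizontal_parabola_mem_segment (hL l hl).1 (hL l hl).2 s (by rcases hs with rfl | rfl <;> norm_num))
      · rcases hs with rfl | rfl <;> simp [apicesAndFeet]
      · simp only [apicesAndFeet, Finset.mem_coe, Finset.mem_insert, Finset.mem_image]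
        exact Or.inr (Or.inr ⟨l, hl, rfl⟩)
    rcases (hS x).1 hx with h | h
    · simpa using mem x h 1 (Or.inl rfl)
    · simpa using mem (-x) h (-1) (Or.inr rfl)

/-- For every `m ≥ 2` some `2m`-gon is a section of a 3-polytope with `m + 2` vertices. -/
theorem exists_2mgon_section_of_polytope_with_m_add_two_vertices
    (m : ℕ) (hm : 2 ≤ m) :
    ∃ (p : Fin (2 * m) → Fin 2 → ℝ)
      (V : Finset (Fin 3 → ℝ)) (f : (Fin 2 → ℝ) →ᵃ[ℝ] (Fin 3 → ℝ)),
      (∀ i j k : Fin (2 * m), i < j → j < k →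
        det3 (hat (p i)) (hat (p j)) (hat (p k)) < 0) ∧
      V.card = m + 2 ∧ Function.Injective f ∧
      convexHull ℝ (V : Set (Fin 3 → ℝ)) ∩ Set.range f =
        f '' (convexHull ℝ (Set.range p)) := by
  have hm0 : (0 : ℝ) < 2 * m := by
    have : 0 < m := by omega
    positivity
  let x : Fin (2 * m) → ℝ := fun i => (2 * (i : ℕ) + 1 - 2 * m) / (2 * m)
  let l : ℕ → ℝ := fun k => (2 * k + 1) / (2 * m)
  have hx : StrictMono x := by
    intro i j hij
    have : ((i : ℕ) : ℝ) < (j : ℕ) := by exact_mod_cast hij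
    exact div_lt_div_of_pos_right (by linarith) hm0
  have hl : Function.Injective l := by
    intro a b hab
    have := (div_left_inj' hm0.ne').1 hab
    exact_mod_cast (by linarith : (a : ℝ) = b)
  have hL : ∀ t ∈ (Finset.range m).image l, 0 < t ∧ t < 1 := by
    intro t ht
    obtain ⟨k, hk, rfl⟩ := Finset.mem_image.1 ht
    have hk' : (k : ℝ) + 1 ≤ m := by exact_mod_cast Finset.mem_range.1 hk
    exact ⟨by positivity, (div_lt_one hm0).2 (by linarith)⟩
  have hS : ∀ t, t ∈ Set.range x ↔
      t ∈ (Finset.range m).image l ∨ -t ∈ (Finset.range m).image l := by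
    intro t
    simp only [Finset.mem_image, Finset.mem_range]
    constructor
    · rintro ⟨i, rfl⟩
      have hi := i.isLt
      rcases le_or_gt m (i : ℕ) with h | h
      · refine Or.inl ⟨i - m, by omega, ?_⟩
        simp only [x, l, Nat.cast_sub h]
        ring
      · refine Or.inr ⟨m - 1 - i, by omega, ?_⟩
        have : ((m - 1 - i : ℕ) : ℝ) = m - 1 - (i : ℕ) := by
          rw [Nat.cast_sub (by omega), Nat.cast_sub (by omega), Nat.cast_one]
        simp only [x, l, this]
        ring
    · rintro (⟨k, hk, rfl⟩ | ⟨k, hk, h⟩)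
      · refine ⟨⟨m + k, by omega⟩, ?_⟩
        simp only [x, l, Nat.cast_add]
        ring
      · refine ⟨⟨m - 1 - k, by omega⟩, ?_⟩
        have : ((m - 1 - k : ℕ) : ℝ) = m - 1 - k := by
          rw [Nat.cast_sub (by omega), Nat.cast_sub (by omega), Nat.cast_one]
        rw [← neg_neg t, ← h]
        simp only [x, l, this]
        ring
  refine ⟨parabola ∘ x, apicesAndFeet ((Finset.range m).image l), horizontal.toAffineMap,
    fun i j k hij hjk => ?_, ?_, horizontal_injective, ?_⟩
  · simp only [Function.comp_apply]
    rw [det3_hat_parabola, neg_lt_zero]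
    have h1 := hx hij
    have h2 := hx hjk
    exact mul_pos (mul_pos (by linarith) (by linarith)) (by linarith)
  · rw [card_apicesAndFeet hL, Finset.card_image_of_injective _ hl, Finset.card_range]
  · rw [Set.range_comp]
    exact convexHull_apicesAndFeet_inter_range hL hS
end

section
/- No hexagon is a section of a polytope with at most 4 vertices in any dimension: if p_0, …, p_5 ∈ ℝ² are in clockwise convex position and P = conv{p_0, …, p_5}, then for every D ≥ 2, every finite set V ⊆ ℝ^D with |V| ≤ 4, and every injective affine map f : ℝ² → ℝ^D, one has conv(V) ∩ range(f) ≠ f(P). Consequently the intersection complexity of a hexagon is either 5 or 6. -/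
open Matrix

lemma mem_extremePoints_convexHull_of_forall_lt {E : Type*} [AddCommGroup E] [Module ℝ E]
    {S : Set E} {x : E} (hx : x ∈ S) (g : E →ₗ[ℝ] ℝ) (hg : ∀ y ∈ S, y = x ∨ g x < g y) :
    x ∈ (convexHull ℝ S).extremePoints ℝ := by
  have hull : ∀ y ∈ convexHull ℝ S, y = x ∨ g x < g y := by
    have hC : Convex ℝ {y | y = x ∨ g x < g y} := by
      rw [convex_iff_forall_pos]
      rintro y hy z hz a b ha hb hab
      simp only [Set.mem_ofPred_eq, map_add, map_smul, smul_eq_mul] at hy hz ⊢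
      have hsum : g x = a * g x + b * g x := by rw [← add_mul, hab, one_mul]
      rcases hy with rfl | hy <;> rcases hz with rfl | hz
      · exact Or.inl (by rw [← add_smul, hab, one_smul])
      · right; nlinarith
      · right; nlinarith
      · right; nlinarith
    exact fun y hy => convexHull_min (t := {y | y = x ∨ g x < g y}) hg hC hy
  rw [mem_extremePoints_iff_left]
  refine ⟨subset_convexHull ℝ S hx, ?_⟩
  rintro y hy z hz ⟨a, b, ha, hb, hab, h⟩
  rcases hull y hy with rfl | hy
  · rfl
  · have hgz : g x ≤ g z := by
      rcases hull z hz with rfl | hz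
      · exact le_rfl
      · exact hz.le
    have := congrArg g h
    simp only [map_add, map_smul, smul_eq_mul] at this
    have hsum : g x = a * g x + b * g x := by rw [← add_mul, hab, one_mul]
    nlinarith

lemma det3_hat (a b c : Fin 2 → ℝ) :
    det3 (hat a) (hat b) (hat c) =
      (b 0 - a 0) * (c 1 - a 1) - (b 1 - a 1) * (c 0 - a 0) := by
  simp [det3, hat, Matrix.det_fin_three]
  ring

/-- The linear part of `x ↦ -(det (b, c, x) + det (a, b, x))`: for consecutive vertices `a`, `b`,
`c` of a polygon in clockwise convex position it is minimised exactly at `b`. -/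
noncomputable def supportingFunctional (a c : Fin 2 → ℝ) : (Fin 2 → ℝ) →ₗ[ℝ] ℝ :=
  (c 1 - a 1) • LinearMap.proj 0 - (c 0 - a 0) • LinearMap.proj 1

lemma supportingFunctional_sub (a b c x : Fin 2 → ℝ) :
    supportingFunctional a c x - supportingFunctional a c b =
      -(det3 (hat b) (hat c) (hat x) + det3 (hat a) (hat b) (hat x)) := by
  simp [supportingFunctional, det3_hat]
  ring

lemma supportingFunctional_lt {p : Fin 6 → Fin 2 → ℝ}
    (hconv : ∀ i j k : Fin 6, i < j → j < k → det3 (hat (p i)) (hat (p j)) (hat (p k)) < 0)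
    {j k : Fin 6} (hjk : k ≠ j) :
    supportingFunctional (p (j - 1)) (p (j + 1)) (p j) <
      supportingFunctional (p (j - 1)) (p (j + 1)) (p k) := by
  have rot : ∀ a b c, det3 (hat a) (hat b) (hat c) = det3 (hat b) (hat c) (hat a) := by
    intro a b c
    rw [det3_hat, det3_hat]
    ring
  have cyc : ∀ i j k : Fin 6, (i < j ∧ j < k) ∨ (j < k ∧ k < i) ∨ (k < i ∧ i < j) →
      det3 (hat (p i)) (hat (p j)) (hat (p k)) < 0 := by
    rintro i j k (⟨h, h'⟩ | ⟨h, h'⟩ | ⟨h, h'⟩)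
    · exact hconv i j k h h'
    · rw [rot]; exact hconv j k i h h'
    · rw [← rot]; exact hconv k i j h h'
  have zero₁ : ∀ a b, det3 (hat a) (hat b) (hat b) = 0 := by
    intro a b
    rw [det3_hat]
    ring
  have zero₂ : ∀ a b, det3 (hat a) (hat b) (hat a) = 0 := by
    intro a b
    rw [det3_hat]
    ring
  rw [← sub_pos, supportingFunctional_sub, neg_pos]
  by_cases h₁ : k = j + 1
  · subst h₁
    rw [zero₁, zero_add]
    exact cyc _ _ _ (by revert j; decide)
  by_cases h₂ : k = j - 1
  · subst h₂
    rw [zero₂, add_zero]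
    exact cyc _ _ _ (by revert j; decide)
  · exact add_neg (cyc _ _ _ (by revert j k; decide)) (cyc _ _ _ (by revert j k; decide))

/-- Equality in Sperner's theorem on four points forces the middle layer. -/
lemma exists_eq_of_card_eq_two {s : Fin 6 → Finset (Fin 4)} (hs : ∀ i j, s i ⊆ s j → i = j)
    {t : Finset (Fin 4)} (ht : t.card = 2) : ∃ i, s i = t := by
  set A : Finset (Finset (Fin 4)) := Finset.univ.image s with hA
  have hcard : A.card = 6 := by
    rw [hA, Finset.card_image_of_injective _ fun i j h => hs i j h.subset]
    rfl
  have hanti : IsAntichain (· ⊆ ·) (A : Set (Finset (Fin 4))) := by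
    intro a ha b hb hab hle
    simp only [hA, Finset.coe_image, Finset.coe_univ, Set.image_univ, Set.mem_range] at ha hb
    obtain ⟨i, rfl⟩ := ha
    obtain ⟨j, rfl⟩ := hb
    exact hab (congrArg s (hs i j hle))
  have hlym := Finset.lubell_yamamoto_meshalkin_inequality_sum_card_div_choose (𝕜 := ℚ) hanti
  have hsum : ∑ r ∈ Finset.range 5, (A.slice r).card = 6 := by
    rw [← hcard, ← Finset.sum_card_slice A, Finset.Iic_eq_Icc, Fintype.card_fin]
    congr 1
  simp only [Fintype.card_fin, Finset.sum_range_succ, Finset.sum_range_zero, zero_add,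
    show Nat.choose 4 0 = 1 from rfl, show Nat.choose 4 1 = 4 from rfl,
    show Nat.choose 4 2 = 6 from rfl, show Nat.choose 4 3 = 4 from rfl,
    show Nat.choose 4 4 = 1 from rfl] at hlym hsum
  have hslice : 6 ≤ (A.slice 2).card := by
    generalize (A.slice 0).card = a₀, (A.slice 1).card = a₁, (A.slice 2).card = a₂,
      (A.slice 3).card = a₃, (A.slice 4).card = a₄ at hlym hsum ⊢
    have hsum' : (a₀ + a₁ + a₂ + a₃ + a₄ : ℚ) = 6 := by exact_mod_cast hsum
    have : (6 : ℚ) ≤ a₂ := by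
      push_cast at hlym
      linarith [a₀.cast_nonneg (α := ℚ), a₁.cast_nonneg (α := ℚ), a₃.cast_nonneg (α := ℚ),
        a₄.cast_nonneg (α := ℚ)]
    exact_mod_cast this
  have hsub : A.slice 2 ⊆ Finset.powersetCard 2 Finset.univ := fun a ha =>
    Finset.mem_powersetCard.2 ⟨Finset.subset_univ _, (Finset.mem_slice.1 ha).2⟩
  have heq : A.slice 2 = Finset.powersetCard 2 Finset.univ :=
    Finset.eq_of_subset_of_card_le hsub (by simpa [Nat.choose] using hslice)
  have htA : t ∈ A.slice 2 := by
    rw [heq]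
    exact Finset.mem_powersetCard.2 ⟨Finset.subset_univ _, ht⟩
  simpa [hA] using (Finset.mem_slice.1 htA).1

lemma exists_pos_forall_mul_le {ι : Type*} [Finite ι] {w w' : ι → ℝ} (hw : ∀ i, 0 ≤ w i)
    (h : ∀ i, w i = 0 → w' i = 0) : ∃ ε > 0, ∀ i, ε * w' i ≤ w i := by
  have key : ∀ᶠ ε in nhdsWithin (0 : ℝ) (Set.Ioi 0), ∀ i, ε * w' i ≤ w i := by
    rw [Filter.eventually_all]
    intro i
    rcases (hw i).eq_or_lt with h₀ | h₀
    · simp [← h₀, h i h₀.symm]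
    · have : Filter.Tendsto (fun ε : ℝ => ε * w' i) (nhdsWithin 0 (Set.Ioi 0)) (nhds 0) := by
        have hc : Continuous fun ε : ℝ => ε * w' i := by fun_prop
        simpa using (hc.tendsto 0).mono_left nhdsWithin_le_nhds
      exact (this.eventually (gt_mem_nhds h₀)).mono fun _ => le_of_lt
  obtain ⟨ε, hε, hpos⟩ := (key.and self_mem_nhdsWithin).exists
  exact ⟨ε, hpos, hε⟩

lemma mem_convexHull_range_iff {ι E : Type*} [Fintype ι] [AddCommGroup E] [Module ℝ E]
    {v : ι → E} {x : E} :
    x ∈ convexHull ℝ (Set.range v) ↔ ∃ w ∈ stdSimplex ℝ ι, ∑ i, w i • v i = x := by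
  classical
  have himage : convexHull ℝ (Set.range v) =
      Fintype.linearCombination ℝ v '' stdSimplex ℝ ι := by
    rw [← convexHull_rangle_single_eq_stdSimplex, LinearMap.image_convexHull, ← Set.range_comp]
    congr 2
    ext i
    simp
  simp [himage, Fintype.linearCombination_apply]

/-- A point of the section whose support is contained in the support of an extreme point
is that extreme point. -/
lemma eq_of_support_subset {ι E F : Type*} [Fintype ι] [AddCommGroup E] [Module ℝ E]
    [AddCommGroup F] [Module ℝ F] {v : ι → F} {f : E →ᵃ[ℝ] F} (hf : Function.Injective f)
    {P : Set E} (hP : convexHull ℝ (Set.range v) ∩ Set.range f = f '' P)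
    {w w' : ι → ℝ} (hw : w ∈ stdSimplex ℝ ι) (hw' : w' ∈ stdSimplex ℝ ι) {x x' : E}
    (hx : ∑ i, w i • v i = f x) (hx' : ∑ i, w' i • v i = f x')
    (hext : x ∈ P.extremePoints ℝ) (h : ∀ i, w i = 0 → w' i = 0) : x' = x := by
  have mem : ∀ u ∈ stdSimplex ℝ ι, ∀ y, ∑ i, u i • v i = f y → y ∈ P := by
    intro u hu y huy
    have : f y ∈ f '' P := hP ▸ ⟨mem_convexHull_range_iff.2 ⟨u, hu, huy⟩, y, rfl⟩
    exact (hf.mem_set_image).1 this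
  obtain ⟨ε, hε, hle⟩ := exists_pos_forall_mul_le hw.1 h
  have hy : AffineMap.lineMap x x' (-ε) ∈ P := by
    refine mem (fun i => w i + ε * (w i - w' i)) ⟨fun i => ?_, ?_⟩ _ ?_
    · nlinarith [hle i, mul_nonneg hε.le (hw.1 i)]
    · rw [Finset.sum_add_distrib, ← Finset.mul_sum, Finset.sum_sub_distrib, hw.2, hw'.2]
      ring
    · rw [AffineMap.apply_lineMap, ← hx, ← hx', AffineMap.lineMap_apply_module,
        Finset.smul_sum, Finset.smul_sum, ← Finset.sum_add_distrib]
      refine Finset.sum_congr rfl fun i _ => ?_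
      module
  rw [mem_extremePoints_iff_left] at hext
  refine hext.2 x' (mem w' hw' x' hx') _ hy ⟨ε / (1 + ε), 1 / (1 + ε), by positivity,
    by positivity, by field_simp; ring, ?_⟩
  rw [AffineMap.lineMap_apply_module]
  match_scalars <;> field_simp <;> ring

lemma mem_range_of_three_crossings {E F : Type*} [AddCommGroup E] [Module ℝ E]
    [AddCommGroup F] [Module ℝ F] {f : E →ᵃ[ℝ] F} {u₀ u₁ u₂ : F} {x y z : E}
    {a b c d r s : ℝ} (ha : 0 < a) (hb : 0 < b) (hc : 0 < c) (hd : 0 < d) (hr : 0 < r)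
    (hs : 0 < s) (hab : a + b = 1) (hcd : c + d = 1) (hrs : r + s = 1)
    (hx : a • u₀ + b • u₁ = f x) (hy : c • u₁ + d • u₂ = f y) (hz : r • u₀ + s • u₂ = f z) :
    u₀ ∈ Set.range f := by
  have hK : r * d * b + s * c * a ≠ 0 := by positivity
  refine ⟨(r * d * b + s * c * a)⁻¹ • ((b * d) • z - (s * b) • y + (s * c) • x), ?_⟩
  have hdec : ∀ t, f t = f.linear t + f 0 := fun t => congrFun f.decomp t
  have hcomb : (b * d) • f z - (s * b) • f y + (s * c) • f x =
      (r * d * b + s * c * a) • u₀ := by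
    rw [← hx, ← hy, ← hz]
    module
  have hcoef : b * d - s * b + s * c = r * d * b + s * c * a := by
    obtain rfl : a = 1 - b := by linarith
    obtain rfl : c = 1 - d := by linarith
    obtain rfl : r = 1 - s := by linarith
    ring
  rw [hdec, ← inv_smul_smul₀ hK u₀, ← hcomb, hdec x, hdec y, hdec z,
    map_smul, map_add, map_sub, map_smul, map_smul, map_smul]
  have hf₀ : f 0 = (r * d * b + s * c * a)⁻¹ • (b * d - s * b + s * c) • f 0 := by
    rw [hcoef, inv_smul_smul₀ hK]
  nth_rewrite 1 [hf₀]
  module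

/-- No hexagon is a section of a polytope with at most 4 vertices in any dimension. -/
theorem hexagon_not_section_of_four_vertex_polytope
    (p : Fin 6 → Fin 2 → ℝ)
    (hconv : ∀ i j k : Fin 6, i < j → j < k →
      det3 (hat (p i)) (hat (p j)) (hat (p k)) < 0) :
    ∀ (D : ℕ), 2 ≤ D →
      ∀ (V : Finset (Fin D → ℝ)) (f : (Fin 2 → ℝ) →ᵃ[ℝ] (Fin D → ℝ)),
        V.card ≤ 4 → Function.Injective f →
        convexHull ℝ (V : Set (Fin D → ℝ)) ∩ Set.range f ≠
          f '' (convexHull ℝ (Set.range p)) := by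
  intro D _ V f hV hf hP
  have hmem : ∀ i, f (p i) ∈ convexHull ℝ (V : Set (Fin D → ℝ)) := fun i =>
    (hP.symm ▸ Set.mem_image_of_mem f (subset_convexHull ℝ _ ⟨i, rfl⟩) :
      f (p i) ∈ convexHull ℝ (V : Set (Fin D → ℝ)) ∩ Set.range f).1
  obtain ⟨v, hv⟩ : ∃ v : Fin 4 → Fin D → ℝ, Set.range v = V := by
    have : Nonempty V := by
      obtain ⟨x, hx⟩ := convexHull_nonempty_iff.1 ⟨_, hmem 0⟩
      exact ⟨⟨x, hx⟩⟩
    obtain ⟨e⟩ := Function.Embedding.nonempty_of_card_le (α := V) (β := Fin 4) (by simpa using hV)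
    refine ⟨Subtype.val ∘ Function.invFun e, ?_⟩
    rw [(Function.invFun_surjective e.injective).range_comp, Subtype.range_val]
  rw [← hv] at hP
  simp only [← hv, mem_convexHull_range_iff] at hmem
  choose W hW hWp using hmem
  have hlt := fun {j k : Fin 6} => supportingFunctional_lt hconv (j := j) (k := k)
  have hext : ∀ j, p j ∈ (convexHull ℝ (Set.range p)).extremePoints ℝ := by
    refine fun j => mem_extremePoints_convexHull_of_forall_lt ⟨j, rfl⟩
      (supportingFunctional (p (j - 1)) (p (j + 1))) ?_
    rintro _ ⟨k, rfl⟩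
    by_cases hkj : k = j
    · exact Or.inl (congrArg p hkj)
    · exact Or.inr (hlt hkj)
  have hinj : Function.Injective p := by
    intro k j h
    by_contra hkj
    exact (hlt hkj).ne (by rw [h])
  have huniq : ∀ j, ∀ w ∈ stdSimplex ℝ (Fin 4), ∀ x, ∑ i, w i • v i = f x →
      (∀ i, W j i = 0 → w i = 0) → x = p j := fun j w hw x hx h =>
    eq_of_support_subset hf hP (hW j) hw (hWp j) hx (hext j) h
  have hpair : ∀ t : Finset (Fin 4), t.card = 2 → ∃ j, ∀ i, W j i ≠ 0 ↔ i ∈ t := by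
    intro t ht
    obtain ⟨j, hj⟩ := exists_eq_of_card_eq_two
      (s := fun j => Finset.univ.filter fun i => W j i ≠ 0) (fun i j h => hinj <|
        huniq j (W i) (hW i) _ (hWp i) fun k hk => by
          by_contra hne
          exact (Finset.mem_filter.1 (h (Finset.mem_filter.2 ⟨Finset.mem_univ k, hne⟩))).2 hk) ht
    exact ⟨j, fun i => by simp [← hj]⟩
  obtain ⟨j, hj⟩ := hpair {0, 1} rfl
  obtain ⟨k, hk⟩ := hpair {1, 2} rfl
  obtain ⟨l, hl⟩ := hpair {0, 2} rfl
  have hpos : ∀ j i, W j i ≠ 0 → 0 < W j i := fun j i h => lt_of_le_of_ne ((hW j).1 i) h.symm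
  have zero : ∀ {j i} {t : Finset (Fin 4)}, (∀ i, W j i ≠ 0 ↔ i ∈ t) → i ∉ t → W j i = 0 :=
    fun h hi => not_not.1 fun hne => hi ((h _).1 hne)
  have hj₂ := zero hj (i := 2) (by decide)
  have hj₃ := zero hj (i := 3) (by decide)
  have hk₀ := zero hk (i := 0) (by decide)
  have hk₃ := zero hk (i := 3) (by decide)
  have hl₁ := zero hl (i := 1) (by decide)
  have hl₃ := zero hl (i := 3) (by decide)
  obtain ⟨q, hq⟩ : v 0 ∈ Set.range f := by
    refine mem_range_of_three_crossings
      (hpos j 0 ((hj _).2 (by decide))) (hpos j 1 ((hj _).2 (by decide)))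
      (hpos k 1 ((hk _).2 (by decide))) (hpos k 2 ((hk _).2 (by decide)))
      (hpos l 0 ((hl _).2 (by decide))) (hpos l 2 ((hl _).2 (by decide)))
      (by simpa [Fin.sum_univ_four, hj₂, hj₃] using (hW j).2)
      (by simpa [Fin.sum_univ_four, hk₀, hk₃] using (hW k).2)
      (by simpa [Fin.sum_univ_four, hl₁, hl₃] using (hW l).2)
      (u₁ := v 1) (u₂ := v 2) (x := p j) (y := p k) (z := p l) ?_ ?_ ?_
    · simpa [Fin.sum_univ_four, hj₂, hj₃] using hWp j
    · simpa [Fin.sum_univ_four, hk₀, hk₃] using hWp k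
    · simpa [Fin.sum_univ_four, hl₁, hl₃] using hWp l
  have hvertex : ∀ m, W m 0 ≠ 0 → q = p m := fun m hm =>
    huniq m (Pi.single 0 1) (single_mem_stdSimplex ℝ 0) q (by simp [hq])
      fun i hi => by
        have : i ≠ 0 := by rintro rfl; exact hm hi
        simp [this]
  have hjl : j = l := hinj <|
    (hvertex j ((hj _).2 (by decide))).symm.trans (hvertex l ((hl _).2 (by decide)))
  exact (hl 1).not.2 (by decide) (hjl ▸ (hj 1).2 (by decide))
end

section
/- For a heptagon with vertices p_0, …, p_6 in clockwise convex position and standardization lines ℓ_i: if ℓ_i is +-crossing, then ℓ_{i−3} is not −-crossing; analogously, if ℓ_i is −-crossing, then ℓ_{i+3} is not +-crossing. -/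
open Matrix

/-- The standardization point `p_i⁺`. -/
noncomputable def pplus (p : Fin 7 → Fin 2 → ℝ) (i : Fin 7) : Fin 3 → ℝ :=
  crossProduct (crossProduct (hat (p (i + 1))) (hat (p (i + 2))))
    (crossProduct (hat (p i)) (hat (p (i + 3))))

/-- The standardization point `p_i⁻`. -/
noncomputable def pminus (p : Fin 7 → Fin 2 → ℝ) (i : Fin 7) : Fin 3 → ℝ :=
  crossProduct (crossProduct (hat (p (i - 1))) (hat (p (i - 2))))
    (crossProduct (hat (p i)) (hat (p (i - 3))))

/-- The `i`-th standardization line `ℓ_i` (in homogeneous line coordinates). -/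
noncomputable def sline (p : Fin 7 → Fin 2 → ℝ) (i : Fin 7) : Fin 3 → ℝ :=
  crossProduct (pplus p i) (pminus p i)

/-- The line `ℓ_i` is `+`-crossing: it separates `p_{i+1}` and `p_{i+2}` from the
remaining vertices of the heptagon. -/
noncomputable def IsPlusCrossing (p : Fin 7 → Fin 2 → ℝ) (i : Fin 7) : Prop :=
  ∃ ε : ℝ, (ε = 1 ∨ ε = -1) ∧
    0 ≤ ε * (sline p i ⬝ᵥ hat (p (i + 1))) ∧
    0 ≤ ε * (sline p i ⬝ᵥ hat (p (i + 2))) ∧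
    ∀ j : Fin 7, j ≠ i + 1 → j ≠ i + 2 → ε * (sline p i ⬝ᵥ hat (p j)) < 0

/-- The line `ℓ_i` is `−`-crossing: it separates `p_{i−1}` and `p_{i−2}` from the
remaining vertices of the heptagon. -/
noncomputable def IsMinusCrossing (p : Fin 7 → Fin 2 → ℝ) (i : Fin 7) : Prop :=
  ∃ ε : ℝ, (ε = 1 ∨ ε = -1) ∧
    0 ≤ ε * (sline p i ⬝ᵥ hat (p (i - 1))) ∧
    0 ≤ ε * (sline p i ⬝ᵥ hat (p (i - 2))) ∧
    ∀ j : Fin 7, j ≠ i - 1 → j ≠ i - 2 → ε * (sline p i ⬝ᵥ hat (p j)) < 0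

theorem det3_eq_cross_dotProduct (u v w : Fin 3 → ℝ) :
    det3 u v w = crossProduct u v ⬝ᵥ w := by
  simp [det3, det_fin_three, cross_apply, dotProduct, Fin.sum_univ_three]
  ring

theorem det3_rotate (u v w : Fin 3 → ℝ) : det3 v w u = det3 u v w := by
  simp [det3, det_fin_three]
  ring

theorem det3_swap (u v w : Fin 3 → ℝ) : det3 u w v = -det3 u v w := by
  simp [det3, det_fin_three]
  ring

theorem cross_cross_dotProduct (L M A v : Fin 3 → ℝ) :
    crossProduct (crossProduct M L) A ⬝ᵥ v = (M ⬝ᵥ A) * (L ⬝ᵥ v) - (L ⬝ᵥ A) * (M ⬝ᵥ v) := by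
  simp [cross_apply, dotProduct, Fin.sum_univ_three]
  ring

theorem Fin.add_left_cyclic_order (k a b c : Fin 7) (hab : a < b) (hbc : b < c) :
    (k + a < k + b ∧ k + b < k + c) ∨ (k + b < k + c ∧ k + c < k + a) ∨
      (k + c < k + a ∧ k + a < k + b) := by
  simp only [Fin.lt_def, Fin.val_add] at *
  omega

/-- Clockwise convex position is invariant under cyclic relabelling. -/
theorem det3_hat_add_left_neg {p : Fin 7 → Fin 2 → ℝ}
    (hconv : ∀ i j k : Fin 7, i < j → j < k →
      det3 (hat (p i)) (hat (p j)) (hat (p k)) < 0)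
    (k a b c : Fin 7) (hab : a < b) (hbc : b < c) :
    det3 (hat (p (k + a))) (hat (p (k + b))) (hat (p (k + c))) < 0 := by
  rcases Fin.add_left_cyclic_order k a b c hab hbc with h | h | h
  · exact hconv _ _ _ h.1 h.2
  · rw [← det3_rotate]
    exact hconv _ _ _ h.1 h.2
  · rw [← det3_rotate, ← det3_rotate]
    exact hconv _ _ _ h.1 h.2

/-- Two members `a * u + b * w` and `a' * u + b' * w` of a pencil whose coefficients `a, a'`
are negative cannot separate two points of the half-plane `w < 0` in opposite ways. -/
theorem pencil_not_separate_oppositely {a b a' b' u₁ w₁ u₂ w₂ : ℝ}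
    (ha : a < 0) (ha' : a' < 0) (hw₁ : w₁ < 0) (hw₂ : w₂ < 0)
    (h₁ : a * u₁ + b * w₁ < 0) (h₂ : 0 ≤ a * u₂ + b * w₂)
    (h₁' : 0 ≤ a' * u₁ + b' * w₁) (h₂' : a' * u₂ + b' * w₂ < 0) : False := by
  have key : u₁ * w₂ < u₂ * w₁ := by nlinarith
  have key' : u₂ * w₁ < u₁ * w₂ := by nlinarith
  exact lt_asymm key key'

theorem not_plusCrossing_and_minusCrossing {p : Fin 7 → Fin 2 → ℝ}
    (hconv : ∀ i j k : Fin 7, i < j → j < k →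
      det3 (hat (p i)) (hat (p j)) (hat (p k)) < 0) (k : Fin 7)
    (hplus : IsPlusCrossing p (k + 3)) (hminus : IsMinusCrossing p k) : False := by
  have hdet := det3_hat_add_left_neg hconv k
  have e₁ : k + 3 + 1 = k + 4 := by omega
  have e₃ : k + 3 - 1 = k + 2 := by omega
  have e₄ : k + 3 - 2 = k + 1 := by omega
  have e₅ : k + 3 - 3 = k + 0 := by omega
  have e₆ : k - 1 = k + 6 := by omega
  set v : Fin 7 → Fin 3 → ℝ := fun j => hat (p (k + j)) with hv
  set L := crossProduct (v 0) (v 3) with hL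
  set M := crossProduct (v 1) (v 2) with hM
  have hM4 : M ⬝ᵥ v 4 < 0 := by
    rw [hM, ← det3_eq_cross_dotProduct]
    exact hdet 1 2 4 (by decide) (by decide)
  have hM6 : M ⬝ᵥ v 6 < 0 := by
    rw [hM, ← det3_eq_cross_dotProduct]
    exact hdet 1 2 6 (by decide) (by decide)
  have hL1 : 0 < L ⬝ᵥ v 1 := by
    rw [hL, ← det3_eq_cross_dotProduct, det3_swap]
    exact neg_pos.mpr (hdet 0 1 3 (by decide) (by decide))
  have hM1 : M ⬝ᵥ v 1 = 0 := by
    rw [hM, dotProduct_comm, dot_self_cross]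
  have hline (x : Fin 3 → ℝ) : sline p k ⬝ᵥ x =
      (M ⬝ᵥ pminus p k) * (L ⬝ᵥ x) - (L ⬝ᵥ pminus p k) * (M ⬝ᵥ x) := by
    rw [← cross_cross_dotProduct]
    simp [sline, pplus, hL, hM, hv]
  have hpminus : pminus p (k + 3) = crossProduct M L := by
    simp only [pminus, e₃, e₄, e₅, hL, hM, hv]
    rw [← cross_anticomm (hat (p (k + 1))), ← cross_anticomm (hat (p (k + 0)))]
    simp only [map_neg, LinearMap.neg_apply, neg_neg]
  have hline' (x : Fin 3 → ℝ) : sline p (k + 3) ⬝ᵥ x =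
      -((M ⬝ᵥ pplus p (k + 3)) * (L ⬝ᵥ x) - (L ⬝ᵥ pplus p (k + 3)) * (M ⬝ᵥ x)) := by
    rw [← cross_cross_dotProduct, sline, hpminus, ← cross_anticomm, neg_dotProduct]
  obtain ⟨ε, -, h6, -, hneg⟩ := hminus
  obtain ⟨ε', -, h4', -, hneg'⟩ := hplus
  rw [e₆] at h6
  rw [e₁] at h4'
  have h1 : ε * (sline p k ⬝ᵥ v 1) < 0 := hneg _ (by omega) (by omega)
  have h4 : ε * (sline p k ⬝ᵥ v 4) < 0 := hneg _ (by omega) (by omega)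
  have h1' : ε' * (sline p (k + 3) ⬝ᵥ v 1) < 0 := hneg' _ (by omega) (by omega)
  have h6' : ε' * (sline p (k + 3) ⬝ᵥ v 6) < 0 := hneg' _ (by omega) (by omega)
  change 0 ≤ ε * (sline p k ⬝ᵥ v 6) at h6
  change 0 ≤ ε' * (sline p (k + 3) ⬝ᵥ v 4) at h4'
  rw [hline] at h1 h4 h6
  rw [hline'] at h1' h4' h6'
  rw [hM1] at h1 h1'
  have ha : ε * (M ⬝ᵥ pminus p k) < 0 :=
    neg_of_mul_neg_left (by linear_combination h1) hL1.le
  have ha' : -(ε' * (M ⬝ᵥ pplus p (k + 3))) < 0 :=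
    neg_of_mul_neg_left (by linear_combination h1') hL1.le
  exact pencil_not_separate_oppositely
    (b := -(ε * (L ⬝ᵥ pminus p k))) (b' := ε' * (L ⬝ᵥ pplus p (k + 3)))
    (u₁ := L ⬝ᵥ v 4) (u₂ := L ⬝ᵥ v 6) ha ha' hM4 hM6
    (by linear_combination h4) (by linear_combination h6)
    (by linear_combination h4') (by linear_combination h6')

/-- Compatibility: if `ℓ_i` is `+`-crossing then `ℓ_{i−3}` is not `−`-crossing, and if
`ℓ_i` is `−`-crossing then `ℓ_{i+3}` is not `+`-crossing. -/
theorem crossing_compatibility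
    (p : Fin 7 → Fin 2 → ℝ)
    (hconv : ∀ i j k : Fin 7, i < j → j < k →
      det3 (hat (p i)) (hat (p j)) (hat (p k)) < 0) (i : Fin 7) :
    (IsPlusCrossing p i → ¬ IsMinusCrossing p (i - 3)) ∧
    (IsMinusCrossing p i → ¬ IsPlusCrossing p (i + 3)) := by
  refine ⟨fun hplus hminus => ?_, fun hminus hplus => ?_⟩
  · exact not_plusCrossing_and_minusCrossing hconv (i - 3) (by simpa using hplus) hminus
  · exact not_plusCrossing_and_minusCrossing hconv i hplus hminus
end
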